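/- arXiv:1206.2973 — 2 statements merged into one kernel-verified Lean document; each statement's English description precedes it below -/
import Mathlib

section
/- Let A be a symmetric N × N matrix over the field 𝔽₂ with two elements, and let d = (a₁₁, a₂₂, …, a_NN) be the vector of its diagonal entries. Then d lies in the range (column space) of A; that is, there exists a vector x ∈ 𝔽₂^N with A x = d. -/
/-- Over `𝔽₂`, the quadratic form of a symmetric matrix is the linear form given by its diagonal. -/
theorem Matrix.IsSymm.dotProduct_mulVec_self_eq_diag_dotProduct {n : Type*} [Fintype n]
    {A : Matrix n n (ZMod 2)} (hA : A.IsSymm) (y : n → ZMod 2) :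
    y ⬝ᵥ A.mulVec y = y ⬝ᵥ A.diag := by
  classical
  have hoff : ∑ p : n × n, (if p.1 = p.2 then 0 else y p.1 * (A p.1 p.2 * y p.2)) = 0 := by
    refine Finset.sum_involution (fun p _ => p.swap) ?_ ?_ (by simp) (by simp)
    · rintro ⟨i, j⟩ -
      by_cases h : i = j
      · simp [h]
      · have hswap : y j * (A j i * y i) = y i * (A i j * y j) := by
          rw [hA.apply i j]
          ring
        simp [h, Ne.symm h, hswap, CharTwo.add_self_eq_zero]
    · rintro ⟨i, j⟩ - h hij
      simp_all
  have hsq (a : ZMod 2) : a * a = a := by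
    revert a
    decide
  rw [Fintype.sum_prod_type] at hoff
  rw [← sub_eq_zero, ← hoff]
  simp only [dotProduct, Matrix.mulVec, Finset.mul_sum, ← Finset.sum_sub_distrib, Matrix.diag_apply]
  refine Finset.sum_congr rfl fun i _ => ?_
  have hdiag : y i * A i i = ∑ j, if i = j then y i * (A i j * y j) else 0 := by
    rw [Finset.sum_ite_eq, if_pos (Finset.mem_univ i), mul_left_comm, hsq, mul_comm]
  rw [hdiag, ← Finset.sum_sub_distrib]
  refine Finset.sum_congr rfl fun j _ => ?_
  split_ifs <;> simp

theorem symm_matrix_diag_in_range (N : ℕ) (A : Matrix (Fin N) (Fin N) (ZMod 2))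
    (hA : A.IsSymm) :
    ∃ x : Fin N → ZMod 2, A.mulVec x = fun i => A i i := by
  change A.diag ∈ LinearMap.range A.mulVecLin
  by_contra hd
  obtain ⟨f, hfd, hf⟩ := Submodule.exists_le_ker_of_notMem hd
  obtain ⟨y, rfl⟩ := (dotProductEquiv (ZMod 2) (Fin N)).surjective f
  refine hfd ?_
  have hy := hf (LinearMap.mem_range_self A.mulVecLin y)
  simpa [hA.dotProduct_mulVec_self_eq_diag_dotProduct] using hy
end

section
/- Let A be a symmetric N × N matrix over the field 𝔽₂, and let d = (a₁₁, a₂₂, …, a_NN) be the vector of its diagonal entries. If x ∈ 𝔽₂^N satisfies A x = 0, then the dot product x · d equals 0; in other words, d is orthogonal to every vector in the null space of A. -/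
/-- In characteristic two, the off-diagonal terms of a symmetric double sum cancel in pairs. -/
theorem CharTwo.sum_sum_eq_sum_diag {ι R : Type*} [DecidableEq ι] [Ring R] [CharP R 2]
    (s : Finset ι) (f : ι → ι → R) (hf : ∀ i j, f i j = f j i) :
    ∑ i ∈ s, ∑ j ∈ s, f i j = ∑ i ∈ s, f i i := by
  have hoff : ∑ p ∈ s.offDiag, f p.1 p.2 = 0 := by
    refine Finset.sum_involution (fun p _ => p.swap) ?_ ?_ ?_ ?_
    · intro p _
      simp [hf p.2 p.1, CharTwo.add_self_eq_zero]
    · intro p hp _ h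
      exact (Finset.mem_offDiag.mp hp).2.2 (congrArg Prod.snd h)
    · intro p hp
      obtain ⟨h₁, h₂, h⟩ := Finset.mem_offDiag.mp hp
      exact Finset.mem_offDiag.mpr ⟨h₂, h₁, h.symm⟩
    · intro p _
      exact p.swap_swap
  rw [← Finset.sum_product', ← Finset.diag_union_offDiag,
    Finset.sum_union (Finset.disjoint_diag_offDiag s), hoff, add_zero, Finset.sum_diag]

theorem diag_orthogonal_nullspace (N : ℕ) (A : Matrix (Fin N) (Fin N) (ZMod 2))
    (hA : A.IsSymm) (x : Fin N → ZMod 2) (hx : A.mulVec x = 0) :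
    ∑ j, x j * A j j = 0 := by
  have hquad : ∑ i, ∑ j, x i * (A i j * x j) = 0 := by
    simp_rw [← Finset.mul_sum]
    exact Finset.sum_eq_zero fun i _ => by
      rw [show ∑ j, A i j * x j = 0 from congrFun hx i, mul_zero]
  have hidem : ∀ a : ZMod 2, a * a = a := by decide
  rw [CharTwo.sum_sum_eq_sum_diag _ _ fun i j => by rw [hA.apply j i]; ring] at hquad
  rw [← hquad]
  refine Finset.sum_congr rfl fun j _ => ?_
  rw [mul_left_comm, hidem, mul_comm]
end
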